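/- arXiv:0809.1656 — 3 statements merged into one kernel-verified Lean document; each statement's English description precedes it below -/
import Mathlib

section
/- Let k ≥ 2, K ≥ 0, and let λ₁ ≥ λ₂ ≥ ⋯ ≥ λ_k ≥ 0 be real numbers satisfying the bounded dilatation condition λ₁ ≤ K·λ₂. Then ∑_{i=1}^{k} λᵢ² ≤ k·K·√(∑_{1 ≤ i < j ≤ k} λᵢ²λⱼ²). (This is the algebraic content of the reverse inequality ‖dφ‖² ≤ kK‖∧²dφ‖ for a map of bounded dilatation of order K.) -/
/-- Bounded dilatation reverse inequality: if `λ₁ ≥ ⋯ ≥ λ_k ≥ 0` (k ≥ 2) and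
`λ₁ ≤ K λ₂`, then `∑ λᵢ² ≤ k K √(∑_{i<j} λᵢ²λⱼ²)`. -/
theorem stmt_1 (k : ℕ) (hk : 2 ≤ k) (K : ℝ) (hK : 0 ≤ K) (lam : Fin k → ℝ)
    (hnn : ∀ i, 0 ≤ lam i)
    (hsort : ∀ i j : Fin k, i ≤ j → lam j ≤ lam i)
    (hdil : lam ⟨0, by omega⟩ ≤ K * lam ⟨1, by omega⟩) :
    (∑ i : Fin k, lam i ^ 2)
      ≤ (k : ℝ) * K *
        Real.sqrt (∑ i : Fin k, ∑ j ∈ Finset.univ.filter (fun j => i < j),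
          lam i ^ 2 * lam j ^ 2) := by
  set a : Fin k := ⟨0, by omega⟩
  set b : Fin k := ⟨1, by omega⟩
  have hab : a < b := Fin.mk_lt_mk.mpr Nat.zero_lt_one
  have hsum : ∑ i : Fin k, lam i ^ 2 ≤ k * lam a ^ 2 := by
    calc ∑ i : Fin k, lam i ^ 2 ≤ ∑ _i : Fin k, lam a ^ 2 :=
          Finset.sum_le_sum fun i _ =>
            pow_le_pow_left₀ (hnn i) (hsort a i (Fin.mk_le_of_le_val (Nat.zero_le _))) 2
      _ = k * lam a ^ 2 := by simp
  have hterm : lam a * lam b ≤ Real.sqrt (∑ i : Fin k,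
      ∑ j ∈ Finset.univ.filter (fun j => i < j), lam i ^ 2 * lam j ^ 2) := by
    apply Real.le_sqrt_of_sq_le
    calc (lam a * lam b) ^ 2 = lam a ^ 2 * lam b ^ 2 := mul_pow _ _ _
      _ ≤ ∑ j ∈ Finset.univ.filter (fun j => a < j), lam a ^ 2 * lam j ^ 2 :=
          Finset.single_le_sum (f := fun j => lam a ^ 2 * lam j ^ 2)
            (fun j _ => by positivity) (by simpa using hab)
      _ ≤ _ := Finset.single_le_sum
            (f := fun i => ∑ j ∈ Finset.univ.filter (fun j => i < j), lam i ^ 2 * lam j ^ 2)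
            (fun i _ => Finset.sum_nonneg fun j _ => by positivity) (Finset.mem_univ a)
  calc ∑ i : Fin k, lam i ^ 2 ≤ k * lam a ^ 2 := hsum
    _ = k * (lam a * lam a) := by rw [sq]
    _ ≤ k * (lam a * (K * lam b)) := by
        have := hnn a
        gcongr
    _ = k * K * (lam a * lam b) := by ring
    _ ≤ _ := by gcongr
end

section
/- Let n ≥ 2 and let λ₁ ≥ λ₂ ≥ ⋯ ≥ λ_n > 0 be real numbers, and set ℓ = λ₁/λ_n. Then 2(∑_{i=1}^{n} λᵢ²) / √(∑_{i=1}^{n} λᵢ⁴ + 4∑_{1 ≤ i < j ≤ n} λᵢ²λⱼ²) ≤ 2√(1 − ((n−1)/(2n−1))·ℓ^{−4}), with equality if and only if λ₁ = λ₂ = ⋯ = λ_n (i.e. ℓ = 1). -/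
open Finset in
/-- The square of a finite sum, split into its diagonal and strictly upper triangular parts. -/
theorem sum_sq_add_two_mul_sum_lt {n : ℕ} (a : Fin n → ℝ) :
    (∑ i, a i ^ 2) + 2 * ∑ i, ∑ j ∈ univ.filter (fun j => i < j), a i * a j
      = (∑ i, a i) ^ 2 := by
  have hlower : ∑ i, ∑ j ∈ univ.filter (fun j => j < i), a i * a j
      = ∑ i, ∑ j ∈ univ.filter (fun j => i < j), a i * a j := by
    simp only [sum_filter]
    rw [sum_comm]
    simp only [mul_comm]
  have hsplit : ∀ i, a i ^ 2 + ∑ j ∈ univ.filter (fun j => i < j), a i * a j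
      + ∑ j ∈ univ.filter (fun j => j < i), a i * a j = ∑ j, a i * a j := by
    intro i
    have hdiag : a i ^ 2 = ∑ j, if i = j then a i * a j else 0 := by
      simp [sq]
    rw [hdiag, sum_filter, sum_filter, ← sum_add_distrib, ← sum_add_distrib]
    refine sum_congr rfl fun j _ => ?_
    rcases lt_trichotomy i j with h | h | h
    · simp [h, h.ne, h.not_gt]
    · simp [h]
    · simp [h, h.ne', h.not_gt]
  rw [sq (∑ i, a i), sum_mul_sum, ← sum_congr rfl fun i _ => hsplit i, sum_add_distrib,
    sum_add_distrib, hlower]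
  ring

open Finset in
/-- The sum of the products `c * c` over the pairs `i < j`. -/
theorem two_mul_sum_lt_const (n : ℕ) (c : ℝ) :
    2 * ∑ i : Fin n, ∑ _j ∈ univ.filter (fun j => i < j), c * c
      = n * (n - 1) * c ^ 2 := by
  have h := sum_sq_add_two_mul_sum_lt (fun _ : Fin n => c)
  simp only [sum_const (c ^ 2), sum_const c, card_univ, Fintype.card_fin, nsmul_eq_mul] at h
  linarith

/-- If `2 Q` is at least `n (n - 1) m ^ 2` and `P + 4 Q` is at most `n (2 n - 1) M ^ 2`, the
quotient `(P + 2 Q) / (P + 4 Q)` is at most `1 - (n - 1) / (2 n - 1) * (m / M) ^ 2`, with equality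
exactly when both bounds are attained. -/
theorem div_le_one_sub_and_eq_iff {n P Q m M : ℝ} (hn : 1 < n) (hm : 0 < m) (hM : 0 < M)
    (hD : 0 < P + 4 * Q) (hQ : n * (n - 1) * m ^ 2 ≤ 2 * Q)
    (hPQ : P + 4 * Q ≤ n * (2 * n - 1) * M ^ 2) :
    (P + 2 * Q) / (P + 4 * Q) ≤ 1 - (n - 1) / (2 * n - 1) * (m ^ 2 / M ^ 2) ∧
      ((P + 2 * Q) / (P + 4 * Q) = 1 - (n - 1) / (2 * n - 1) * (m ^ 2 / M ^ 2) ↔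
        P + 4 * Q = n * (2 * n - 1) * M ^ 2 ∧ 2 * Q = n * (n - 1) * m ^ 2) := by
  have h1 : 0 < n - 1 := by linarith
  have h2 : 0 < 2 * n - 1 := by linarith
  have hK : 0 < (2 * n - 1) * M ^ 2 := by positivity
  have hk : 0 < (n - 1) * m ^ 2 := by positivity
  have hrhs : 1 - (n - 1) / (2 * n - 1) * (m ^ 2 / M ^ 2)
      = ((2 * n - 1) * M ^ 2 - (n - 1) * m ^ 2) / ((2 * n - 1) * M ^ 2) := by
    rw [div_mul_div_comm, sub_div, div_self hK.ne']
  have hA := mul_le_mul_of_nonneg_left hPQ hk.le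
  have hB := mul_le_mul_of_nonneg_left hQ hK.le
  rw [hrhs, div_le_div_iff₀ hD hK, div_eq_div_iff hD.ne' hK.ne']
  refine ⟨by linarith, fun h => ⟨?_, ?_⟩, fun ⟨hP, hQ⟩ => ?_⟩
  · exact mul_left_cancel₀ hk.ne' (by linarith)
  · exact mul_left_cancel₀ hK.ne' (by linarith)
  · linear_combination (n - 1) * m ^ 2 * hP - (2 * n - 1) * M ^ 2 * hQ

/-- Refined Schwarz-lemma estimate: for `λ₁ ≥ ⋯ ≥ λ_n > 0` (n ≥ 2) with `ℓ = λ₁/λ_n`,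
`2 ∑ λᵢ² / √(∑ λᵢ⁴ + 4 ∑_{i<j} λᵢ²λⱼ²) ≤ 2 √(1 − ((n−1)/(2n−1)) ℓ⁻⁴)`,
with equality iff all `λᵢ` are equal. -/
theorem stmt_3 (n : ℕ) (hn : 2 ≤ n) (lam : Fin n → ℝ) (hpos : ∀ i, 0 < lam i)
    (hsort : ∀ i j : Fin n, i ≤ j → lam j ≤ lam i) :
    (2 * (∑ i : Fin n, lam i ^ 2) /
        Real.sqrt ((∑ i : Fin n, lam i ^ 4)
          + 4 * ∑ i : Fin n, ∑ j ∈ Finset.univ.filter (fun j => i < j),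
              lam i ^ 2 * lam j ^ 2)
      ≤ 2 * Real.sqrt (1 - ((n : ℝ) - 1) / (2 * n - 1) *
          ((lam ⟨0, by omega⟩ / lam ⟨n - 1, by omega⟩) ^ 4)⁻¹))
    ∧ (2 * (∑ i : Fin n, lam i ^ 2) /
        Real.sqrt ((∑ i : Fin n, lam i ^ 4)
          + 4 * ∑ i : Fin n, ∑ j ∈ Finset.univ.filter (fun j => i < j),
              lam i ^ 2 * lam j ^ 2)
      = 2 * Real.sqrt (1 - ((n : ℝ) - 1) / (2 * n - 1) *
          ((lam ⟨0, by omega⟩ / lam ⟨n - 1, by omega⟩) ^ 4)⁻¹)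
      ↔ ∀ i j : Fin n, lam i = lam j) := by
  have hn1 : (1 : ℝ) < n := by exact_mod_cast hn
  set f : Fin n := ⟨0, by omega⟩
  set l : Fin n := ⟨n - 1, by omega⟩
  have hle : ∀ i, lam i ^ 2 ≤ lam f ^ 2 := fun i =>
    pow_le_pow_left₀ (hpos i).le (hsort f i (Fin.mk_le_of_le_val (Nat.zero_le _))) 2
  have hge : ∀ i, lam l ^ 2 ≤ lam i ^ 2 := fun i =>
    pow_le_pow_left₀ (hpos l).le (hsort i l (Fin.le_def.2 (Nat.le_sub_one_of_lt i.isLt))) 2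
  have hm : 0 < lam l ^ 2 := pow_pos (hpos l) 2
  have hM : 0 < lam f ^ 2 := pow_pos (hpos f) 2
  have hS := sum_sq_add_two_mul_sum_lt (fun i => lam i ^ 2)
  have hfour : ∀ i, lam i ^ 4 = (lam i ^ 2) ^ 2 := fun i => by ring
  have hratio : ((lam f / lam l) ^ 4)⁻¹ = (lam l ^ 2) ^ 2 / (lam f ^ 2) ^ 2 := by
    rw [div_pow, inv_div, hfour, hfour]
  rw [hratio]
  simp only [hfour]
  have hQlow : n * ((n : ℝ) - 1) * (lam l ^ 2) ^ 2
      ≤ 2 * ∑ i, ∑ j ∈ Finset.univ.filter (fun j => i < j), lam i ^ 2 * lam j ^ 2 := by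
    rw [← two_mul_sum_lt_const]
    gcongr 2 * ?_
    exact Finset.sum_le_sum fun i _ => Finset.sum_le_sum fun j _ =>
      mul_le_mul (hge i) (hge j) hm.le (sq_nonneg _)
  have hQup : 2 * ∑ i, ∑ j ∈ Finset.univ.filter (fun j => i < j), lam i ^ 2 * lam j ^ 2
      ≤ n * ((n : ℝ) - 1) * (lam f ^ 2) ^ 2 := by
    rw [← two_mul_sum_lt_const]
    gcongr 2 * ?_
    exact Finset.sum_le_sum fun i _ => Finset.sum_le_sum fun j _ =>
      mul_le_mul (hle i) (hle j) (sq_nonneg _) hM.le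
  have hsq : ∀ i, (lam i ^ 2) ^ 2 ≤ (lam f ^ 2) ^ 2 := fun i =>
    pow_le_pow_left₀ (sq_nonneg _) (hle i) 2
  have hconst : ∑ _i : Fin n, (lam f ^ 2) ^ 2 = n * (lam f ^ 2) ^ 2 := by simp
  have hPup : ∑ i, (lam i ^ 2) ^ 2 ≤ n * (lam f ^ 2) ^ 2 :=
    hconst ▸ Finset.sum_le_sum fun i _ => hsq i
  have hPeq : ∑ i, (lam i ^ 2) ^ 2 = n * (lam f ^ 2) ^ 2 ↔ ∀ i, lam i = lam f := by
    refine ⟨fun h i => ?_, fun h => by simp [h]⟩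
    rw [← hconst, Finset.sum_eq_sum_iff_of_le fun i _ => hsq i] at h
    have h' := h i (Finset.mem_univ i)
    rw [← hfour, ← hfour] at h'
    exact (pow_left_inj₀ (hpos i).le (hpos f).le (by norm_num)).1 h'
  have hPnonneg : 0 ≤ ∑ i, (lam i ^ 2) ^ 2 := Finset.sum_nonneg fun i _ => sq_nonneg _
  have hSnonneg : 0 ≤ ∑ i, lam i ^ 2 := Finset.sum_nonneg fun i _ => sq_nonneg _
  have hlow : 0 < n * ((n : ℝ) - 1) * (lam l ^ 2) ^ 2 := by
    have : 0 < (n : ℝ) - 1 := by linarith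
    positivity
  generalize (∑ i, ∑ j ∈ Finset.univ.filter (fun j => i < j), lam i ^ 2 * lam j ^ 2) = Q at *
  generalize (∑ i, (lam i ^ 2) ^ 2) = P at *
  generalize (∑ i, lam i ^ 2) = S at *
  have hD : 0 < P + 4 * Q := by linarith
  obtain ⟨hineq, heq⟩ := div_le_one_sub_and_eq_iff hn1 hm hM hD hQlow (by linarith)
  have hquot : 0 ≤ (P + 2 * Q) / (P + 4 * Q) := div_nonneg (by linarith) hD.le
  have hlhs : 2 * S / √(P + 4 * Q) = 2 * √((P + 2 * Q) / (P + 4 * Q)) := by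
    rw [hS, Real.sqrt_div (sq_nonneg S), Real.sqrt_sq hSnonneg, mul_div_assoc]
  rw [hlhs]
  refine ⟨by gcongr, ?_⟩
  rw [mul_right_inj' two_ne_zero, Real.sqrt_inj hquot (hquot.trans hineq), heq]
  refine ⟨fun ⟨hmax, _⟩ i j => ?_, fun h => ?_⟩
  · have hP : P = n * (lam f ^ 2) ^ 2 := by linarith
    rw [hPeq.1 hP i, hPeq.1 hP j]
  · have hP := hPeq.2 fun i => h i f
    rw [h l f] at hQlow ⊢
    constructor <;> linarith
end

section
/- Let n ≥ 2 and let λ₁ ≥ λ₂ ≥ ⋯ ≥ λ_n > 0 be real numbers, and set ℓ = λ₁/λ_n. Then (∑_{i=1}^{n} λᵢ²)² ≤ (2n/(n−1))·ℓ⁴·∑_{1 ≤ i < j ≤ n} λᵢ²λⱼ². -/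
/-- The number of pairs `i < j` in `Fin n`, counted row by row, is `n (n - 1) / 2`. -/
lemma Fin.sum_card_filter_lt (n : ℕ) :
    ∑ i : Fin n, ((Finset.univ.filter (fun j => i < j)).card : ℝ) = n * ((n : ℝ) - 1) / 2 := by
  have hcard (i : Fin n) : (Finset.univ.filter (fun j => i < j)).card = n - 1 - (i : ℕ) := by
    rw [← Fin.card_Ioi i]
    congr 1
    ext j
    simp
  simp only [hcard]
  rw [Fin.sum_univ_eq_sum_range (fun k => ((n - 1 - k : ℕ) : ℝ)) n,
    Finset.sum_range_reflect (fun k => (k : ℝ)) n]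
  clear hcard
  induction n with
  | zero => simp
  | succ n ih =>
    rw [Finset.sum_range_succ, ih]
    push_cast
    ring

/-- For `λ₁ ≥ ⋯ ≥ λ_n > 0` (n ≥ 2) with `ℓ = λ₁/λ_n`:
`(∑ λᵢ²)² ≤ (2n/(n−1)) ℓ⁴ ∑_{i<j} λᵢ²λⱼ²`. -/
theorem stmt_4 (n : ℕ) (hn : 2 ≤ n) (lam : Fin n → ℝ) (hpos : ∀ i, 0 < lam i)
    (hsort : ∀ i j : Fin n, i ≤ j → lam j ≤ lam i) :
    (∑ i : Fin n, lam i ^ 2) ^ 2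
      ≤ (2 * n) / ((n : ℝ) - 1) * (lam ⟨0, by omega⟩ / lam ⟨n - 1, by omega⟩) ^ 4 *
        ∑ i : Fin n, ∑ j ∈ Finset.univ.filter (fun j => i < j),
          lam i ^ 2 * lam j ^ 2 := by
  have hn1 : (0 : ℝ) < (n : ℝ) - 1 := by
    have : (2 : ℝ) ≤ n := by exact_mod_cast hn
    linarith
  set a := lam ⟨0, by omega⟩
  set b := lam ⟨n - 1, by omega⟩
  have hb0 : 0 < b := hpos _
  have hla (i : Fin n) : lam i ≤ a := hsort _ _ (Fin.mk_le_of_le_val (Nat.zero_le _))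
  have hbl (i : Fin n) : b ≤ lam i := hsort _ _ (Fin.le_def.2 (Nat.le_sub_one_of_lt i.isLt))
  have hS : ∑ i : Fin n, lam i ^ 2 ≤ n * a ^ 2 := by
    have h := Finset.sum_le_card_nsmul Finset.univ (fun i => lam i ^ 2) (a ^ 2)
      fun i _ => pow_le_pow_left₀ (hpos i).le (hla i) 2
    simpa using h
  have hQ : n * ((n : ℝ) - 1) / 2 * b ^ 4 ≤
      ∑ i : Fin n, ∑ j ∈ Finset.univ.filter (fun j => i < j), lam i ^ 2 * lam j ^ 2 := by
    rw [← Fin.sum_card_filter_lt, Finset.sum_mul]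
    refine Finset.sum_le_sum fun i _ => ?_
    rw [← nsmul_eq_mul]
    refine Finset.card_nsmul_le_sum _ _ _ fun j _ => ?_
    calc b ^ 4 = b ^ 2 * b ^ 2 := by ring
      _ ≤ lam i ^ 2 * lam j ^ 2 := by
        gcongr
        · exact hbl i
        · exact hbl j
  calc (∑ i : Fin n, lam i ^ 2) ^ 2 ≤ (n * a ^ 2) ^ 2 :=
        pow_le_pow_left₀ (Finset.sum_nonneg fun i _ => sq_nonneg _) hS 2
    _ = (2 * n) / ((n : ℝ) - 1) * (a / b) ^ 4 * (n * ((n : ℝ) - 1) / 2 * b ^ 4) := by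
        field_simp
    _ ≤ _ := by gcongr
end
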